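/- Let 0 < σ ≤ √2, let t₁ < … < t_k be points in [0,1] with t_{i+1} − t_i ≥ Δ for all i, where Δ > σ √(log(3 + 4/σ²)). Define g(t) = exp(−t²/σ²), the 2×2 matrix H(t) = [[g(t), −g′(t)], [g′(t), −g″(t)]], and the symmetric matrix B ∈ ℝ^{2k×2k} whose (i,j)-th 2×2 block equals H(tᵢ − tⱼ) (so the diagonal blocks are H(0) = diag(1, 2/σ²)). Assume 0 < F_min < 1, where F_min = 1 − (1 + 2/σ²) · 2 e^{−Δ²/σ²} / (1 − e^{−Δ²/σ²}). Then every eigenvalue of B is at least F_min. -/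

import Mathlib

open Set Matrix

/-- The 2×2 block `H(d) = [[g(d), -g'(d)], [g'(d), -g''(d)]]` for the Gaussian window
`g(d) = exp(-d²/σ²)`, written entrywise:
`H(d) = [[e^{-d²/σ²}, (2d/σ²)e^{-d²/σ²}], [-(2d/σ²)e^{-d²/σ²}, (2/σ² - 4d²/σ⁴)e^{-d²/σ²}]]`.
In particular `H(0) = diag(1, 2/σ²)`. -/
noncomputable def gaussH (σ d : ℝ) : Fin 2 → Fin 2 → ℝ := fun r c =>
  if r = 0 then
    (if c = 0 then Real.exp (-d ^ 2 / σ ^ 2)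
     else (2 * d / σ ^ 2) * Real.exp (-d ^ 2 / σ ^ 2))
  else
    (if c = 0 then -(2 * d / σ ^ 2) * Real.exp (-d ^ 2 / σ ^ 2)
     else (2 / σ ^ 2 - 4 * d ^ 2 / σ ^ 4) * Real.exp (-d ^ 2 / σ ^ 2))


lemma aux_sep {k : ℕ} {Δ : ℝ} {t : Fin k → ℝ}
    (hsep : ∀ i j : Fin k, (i : ℕ) + 1 = (j : ℕ) → Δ ≤ t j - t i) :
    ∀ n : ℕ, ∀ i j : Fin k, (i : ℕ) + n = (j : ℕ) → n * Δ ≤ t j - t i := by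
  intro n
  induction n with
  | zero =>
    intro i j h
    have : i = j := Fin.ext (by simpa using h)
    subst this
    simp
  | succ n ih =>
    intro i j h
    have hl : (i : ℕ) + n < k := by have := j.isLt; omega
    have h1 := ih i ⟨i + n, hl⟩ rfl
    have h2 := hsep ⟨i + n, hl⟩ j (by simp only; omega)
    push_cast
    linarith

/-- index distance minus one -/
def aux_m {k : ℕ} (i j : Fin k) : ℕ := ((i : ℕ) - j) + ((j : ℕ) - i) - 1

lemma aux_sep2 {k : ℕ} {Δ : ℝ} {t : Fin k → ℝ}
    (hsep : ∀ i j : Fin k, (i : ℕ) + 1 = (j : ℕ) → Δ ≤ t j - t i)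
    (i j : Fin k) (hij : j ≠ i) :
    ((aux_m i j : ℕ) + 1 : ℝ) * Δ ≤ |t i - t j| := by
  have hne : (j : ℕ) ≠ i := fun h => hij (Fin.ext h)
  rcases lt_or_gt_of_ne hne with h | h
  · have := aux_sep hsep (aux_m i j + 1) j i (by unfold aux_m; omega)
    push_cast at this
    exact this.trans (le_abs_self _)
  · have := aux_sep hsep (aux_m i j + 1) i j (by unfold aux_m; omega)
    push_cast at this
    rw [abs_sub_comm]
    exact this.trans (le_abs_self _)

lemma aux_geom_inj {ι : Type*} (S : Finset ι) (φ : ι → ℕ) (hφ : Set.InjOn φ S) {s : ℝ}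
    (hs0 : 0 ≤ s) (hs1 : s < 1) : ∑ j ∈ S, s ^ (φ j) ≤ (1 - s)⁻¹ := by
  classical
  rw [← tsum_geometric_of_lt_one hs0 hs1,
    ← Finset.sum_image (f := fun n => s ^ n) hφ]
  exact (summable_geometric_of_lt_one hs0 hs1).sum_le_tsum _ (fun n _ => pow_nonneg hs0 n)

lemma aux_geom {k : ℕ} (i : Fin k) {s : ℝ} (hs0 : 0 ≤ s) (hs1 : s < 1) :
    ∑ j ∈ Finset.univ.erase i, s ^ (aux_m i j) ≤ 2 * (1 - s)⁻¹ := by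
  classical
  rw [← Finset.sum_filter_add_sum_filter_not _ (fun j => j < i)]
  have h1 : ∑ j ∈ (Finset.univ.erase i).filter (fun j => j < i), s ^ (aux_m i j) ≤ (1 - s)⁻¹ := by
    apply aux_geom_inj _ _ _ hs0 hs1
    intro x hx y hy hxy
    simp only [Finset.coe_filter, Finset.mem_erase, Finset.mem_univ, Set.mem_ofPred_eq,
      Fin.lt_def] at hx hy
    simp only [aux_m] at hxy
    apply Fin.ext
    omega
  have h2 : ∑ j ∈ (Finset.univ.erase i).filter (fun j => ¬ j < i), s ^ (aux_m i j)
      ≤ (1 - s)⁻¹ := by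
    apply aux_geom_inj _ _ _ hs0 hs1
    intro x hx y hy hxy
    simp only [Finset.coe_filter, Finset.mem_erase, Finset.mem_univ, Set.mem_ofPred_eq,
      Fin.lt_def, ne_eq, Fin.ext_iff] at hx hy
    simp only [aux_m] at hxy
    apply Fin.ext
    omega
  linarith

lemma aux_exp (x : ℝ) : (2 * x - 1) * Real.exp (-x) ≤ 1.2 * Real.exp (-x / 2) := by
  have h1 : x / 2 - 1.25 + 1 ≤ Real.exp (x / 2 - 1.25) := Real.add_one_le_exp _
  have h2 : (10 / 3 : ℝ) ≤ Real.exp 1.25 := by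
    have := Real.quadratic_le_exp_of_nonneg (x := 0.25) (by norm_num)
    have h3 : Real.exp 1.25 = Real.exp 1 * Real.exp 0.25 := by
      rw [← Real.exp_add]; norm_num
    have := Real.exp_one_gt_d9
    nlinarith
  have h4 : Real.exp (x / 2) = Real.exp (x / 2 - 1.25) * Real.exp 1.25 := by
    rw [← Real.exp_add]; ring_nf
  have h5 : (2 * x - 1) ≤ 1.2 * Real.exp (x / 2) := by
    have := Real.exp_pos (x / 2 - 1.25)
    nlinarith
  have h6 : Real.exp (-x / 2) = Real.exp (x / 2) * Real.exp (-x) := by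
    rw [← Real.exp_add]; ring_nf
  rw [h6, ← mul_assoc]
  exact mul_le_mul_of_nonneg_right h5 (Real.exp_pos _).le

lemma aux_a {a : ℝ} (ha : 1 ≤ a) (h : Real.log (3 + 2 * a) < a / 2) : 4.1 ≤ a := by
  by_contra hc
  push Not at hc
  have h1 : 3 + 2 * a < Real.exp (a / 2) := by
    rwa [Real.log_lt_iff_lt_exp (by linarith)] at h
  have e1 : Real.exp 1 < 2.7182818286 := Real.exp_one_lt_d9
  have e0 := Real.exp_pos 1
  rcases le_or_gt a 2 with h2 | h2
  · have : Real.exp (a / 2) ≤ Real.exp 1 := Real.exp_le_exp.mpr (by linarith)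
    linarith
  rcases le_or_gt a 4 with h3 | h3
  · have : Real.exp (a / 2) ≤ Real.exp 1 * Real.exp 1 := by
      rw [← Real.exp_add]; exact Real.exp_le_exp.mpr (by linarith)
    by_cases h5 : a ≤ 3
    · have h6 : Real.exp (a / 2) * Real.exp (a / 2) ≤ Real.exp 1 * Real.exp 1 * Real.exp 1 := by
        rw [← Real.exp_add, ← Real.exp_add, ← Real.exp_add]
        exact Real.exp_le_exp.mpr (by linarith)
      have h7 : Real.exp 1 * Real.exp 1 < 7.4 := by nlinarith
      nlinarith
    · nlinarith
  · have h4 : Real.exp (a / 2) ≤ Real.exp 1 * Real.exp 1 * Real.exp 0.05 := by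
      rw [← Real.exp_add, ← Real.exp_add]; exact Real.exp_le_exp.mpr (by linarith)
    have h7 : Real.exp 1 * Real.exp 1 < 7.4 := by nlinarith
    have h8 : (-0.05 : ℝ) + 1 ≤ Real.exp (-0.05) := Real.add_one_le_exp _
    have h9 : Real.exp 0.05 * Real.exp (-0.05) = 1 := by
      rw [← Real.exp_add]; norm_num
    have h10 := Real.exp_pos 0.05
    have h11 : Real.exp 0.05 ≤ 1.1 := by nlinarith
    nlinarith

lemma aux_row0 {a d : ℝ} (ha : 0 ≤ a) (hd : |d| ≤ 1) (E : ℝ) (hE : 0 ≤ E) :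
    |E| + |a * d * E| ≤ (1 + a) * E := by
  rw [abs_mul, abs_mul, abs_of_nonneg hE, abs_of_nonneg ha]
  have := mul_le_mul_of_nonneg_left hd (mul_nonneg ha hE)
  linarith

lemma aux_row1 {a d x : ℝ} (ha : 0 ≤ a) (hd : |d| ≤ 1) (hx : 1 ≤ x) :
    |-(a * d) * Real.exp (-x)| + |(a - 2 * a * x) * Real.exp (-x)|
      ≤ a * Real.exp (-x) + 1.2 * a * Real.exp (-x / 2) := by
  have hE := (Real.exp_pos (-x)).le
  have h0 : a - 2 * a * x ≤ 0 := by nlinarith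
  rw [abs_mul, abs_mul, abs_neg, abs_mul, abs_of_nonneg hE, abs_of_nonneg ha, abs_of_nonpos h0]
  have := mul_le_mul_of_nonneg_left hd (mul_nonneg ha hE)
  have := mul_le_mul_of_nonneg_left (aux_exp x) ha
  linarith

lemma aux_reindex {k : ℕ} (f : Fin (2 * k) → ℝ) :
    ∑ q, f q = ∑ j : Fin k, (f ⟨2 * j, by omega⟩ + f ⟨2 * j + 1, by omega⟩) := by
  let e : Fin k × Fin 2 → Fin (2 * k) := fun x => ⟨2 * x.1 + x.2, by omega⟩
  have he : Function.Bijective e := by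
    constructor
    · rintro ⟨a, b⟩ ⟨c, d⟩ h
      simp only [e, Fin.mk.injEq] at h
      ext <;> simp only <;> omega
    · intro q
      refine ⟨(⟨q / 2, by omega⟩, ⟨q % 2, by omega⟩), ?_⟩
      apply Fin.ext
      simp only [e]
      omega
  rw [← he.sum_comp f, Fintype.sum_prod_type]
  simp [e, Fin.sum_univ_two]

lemma aux_r {r a : ℝ} (hr0 : 0 < r) (ha : 4.1 ≤ a) (h : r ^ 2 * (3 + 2 * a) < 1) : r ≤ 0.3 := by
  have h1 : r ^ 2 * 11.2 ≤ r ^ 2 * (3 + 2 * a) :=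
    mul_le_mul_of_nonneg_left (by linarith) (sq_nonneg r)
  by_contra hcon
  push Not at hcon
  nlinarith

set_option maxHeartbeats 1000000 in
/-- **Eigenvalue lower bound for the Gaussian interpolation matrix (Lemma: lower bound on B).**
For `0 < σ ≤ √2` and sources `t₁ < … < t_k ⊂ [0,1]` with consecutive gaps at least
`Δ > σ√(log(3 + 4/σ²))`, the symmetric `2k × 2k` block matrix `B` with `(i,j)`-th block
`H(tᵢ - tⱼ)` has all its eigenvalues at least
`F_min = 1 - (1 + 2/σ²)·2e^{-Δ²/σ²}/(1 - e^{-Δ²/σ²})`, assumed to lie in `(0,1)`. -/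
theorem gaussian_block_matrix_eigenvalue_bound
    (σ : ℝ) (hσ0 : 0 < σ) (hσ : σ ≤ Real.sqrt 2)
    (k : ℕ) (Δ : ℝ)
    (t : Fin k → ℝ) (ht : ∀ i, t i ∈ Icc (0:ℝ) 1)
    (hΔ : σ * Real.sqrt (Real.log (3 + 4 / σ ^ 2)) < Δ)
    (hsep : ∀ i j : Fin k, (i : ℕ) + 1 = (j : ℕ) → Δ ≤ t j - t i)
    (Fmin : ℝ)
    (hFmin_def : Fmin = 1 - (1 + 2 / σ ^ 2)
      * (2 * Real.exp (-Δ ^ 2 / σ ^ 2) / (1 - Real.exp (-Δ ^ 2 / σ ^ 2))))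
    (hFmin_pos : 0 < Fmin) (hFmin_lt : Fmin < 1)
    (B : Matrix (Fin (2 * k)) (Fin (2 * k)) ℝ)
    (hB : ∀ p q : Fin (2 * k),
      B p q = gaussH σ
        (t ⟨(p : ℕ) / 2, by have := p.isLt; omega⟩
          - t ⟨(q : ℕ) / 2, by have := q.isLt; omega⟩)
        ⟨(p : ℕ) % 2, by omega⟩ ⟨(q : ℕ) % 2, by omega⟩) :
    ∀ μ ∈ spectrum ℝ B, Fmin ≤ μ := by
  intro μ hμ
  have hμ' : Module.End.HasEigenvalue (Matrix.toLin' B) μ := by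
    rw [Module.End.hasEigenvalue_iff_mem_spectrum, Matrix.spectrum_toLin']
    exact hμ
  obtain ⟨p, hp⟩ := eigenvalue_mem_ball hμ'
  rw [Metric.mem_closedBall, Real.dist_eq] at hp
  have hlow := (abs_le.mp hp).1
  clear hp hμ' hμ
  simp only [Real.norm_eq_abs] at hlow
  -- parameters
  have hσ2 : σ ^ 2 ≤ 2 := by
    have := Real.sq_sqrt (show (0:ℝ) ≤ 2 by norm_num)
    nlinarith [Real.sqrt_nonneg 2]
  have hσp : 0 < σ ^ 2 := by positivity
  obtain ⟨a, ha⟩ : ∃ a, a = 2 / σ ^ 2 := ⟨_, rfl⟩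
  have ha1 : 1 ≤ a := by rw [ha, le_div_iff₀ hσp]; linarith
  have hH : ∀ d, gaussH σ d 0 0 = Real.exp (-(a / 2 * d ^ 2)) ∧
      gaussH σ d 0 1 = a * d * Real.exp (-(a / 2 * d ^ 2)) ∧
      gaussH σ d 1 0 = -(a * d) * Real.exp (-(a / 2 * d ^ 2)) ∧
      gaussH σ d 1 1 = (a - 2 * a * (a / 2 * d ^ 2)) * Real.exp (-(a / 2 * d ^ 2)) := by
    intro d
    have h1 : -d ^ 2 / σ ^ 2 = -(a / 2 * d ^ 2) := by rw [ha]; field_simp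
    have h2 : 2 * d / σ ^ 2 = a * d := by rw [ha]; field_simp
    have h3 : 2 / σ ^ 2 - 4 * d ^ 2 / σ ^ 4 = a - 2 * a * (a / 2 * d ^ 2) := by
      rw [ha]; field_simp; ring
    simp [gaussH, h1, h2, h3]
  have hlog4 : 3 + 4 / σ ^ 2 = 3 + 2 * a := by rw [ha]; ring
  have hE : -Δ ^ 2 / σ ^ 2 = -(a / 2 * Δ ^ 2) := by rw [ha]; field_simp
  rw [hlog4] at hΔ
  rw [hE, ← ha] at hFmin_def
  obtain ⟨x, hx⟩ : ∃ x, x = a / 2 * Δ ^ 2 := ⟨_, rfl⟩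
  rw [← hx] at hFmin_def
  have hlogpos : 0 < Real.log (3 + 2 * a) := Real.log_pos (by linarith)
  have hΔ0 : 0 < Δ := lt_of_le_of_lt (by positivity) hΔ
  have hxlog : Real.log (3 + 2 * a) < x := by
    have h1 : (σ * Real.sqrt (Real.log (3 + 2 * a))) ^ 2 < Δ ^ 2 := by
      apply pow_lt_pow_left₀ hΔ (by positivity) (by norm_num)
    rw [mul_pow, Real.sq_sqrt hlogpos.le] at h1
    have : x = Δ ^ 2 / σ ^ 2 := by rw [hx, ha]; field_simp
    rw [this, lt_div_iff₀ hσp]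
    linarith
  have hx1 : 1 ≤ x := by
    have : Real.log (Real.exp 1) ≤ Real.log (3 + 2 * a) :=
      Real.log_le_log (Real.exp_pos _) (by have := Real.exp_one_lt_d9; linarith)
    rw [Real.log_exp] at this
    linarith
  obtain ⟨r, hr⟩ : ∃ r, r = Real.exp (-x / 2) := ⟨_, rfl⟩
  have hr0 : 0 < r := hr ▸ Real.exp_pos _
  have hq : Real.exp (-x) = r ^ 2 := by
    rw [hr, ← Real.exp_nat_mul]; congr 1; push_cast; ring
  have hqlt : r ^ 2 * (3 + 2 * a) < 1 := by
    have h1 : 3 + 2 * a < Real.exp x := by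
      rwa [Real.log_lt_iff_lt_exp (by linarith)] at hxlog
    have h2 : Real.exp (-x) * Real.exp x = 1 := by rw [← Real.exp_add]; simp
    rw [hq] at h2
    nlinarith [pow_pos hr0 2]
  rw [hq] at hFmin_def
  have hr1 : r ^ 2 < 1 := by nlinarith [pow_pos hr0 2]
  -- the index
  obtain ⟨i, hi⟩ : ∃ i : Fin k, i = ⟨(p : ℕ) / 2, by have := p.isLt; omega⟩ := ⟨_, rfl⟩
  obtain ⟨c, hc⟩ : ∃ c : Fin 2, c = ⟨(p : ℕ) % 2, by omega⟩ := ⟨_, rfl⟩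
  have hrow : ∀ j : Fin k, B p ⟨2 * j, by omega⟩ = gaussH σ (t i - t j) c 0 ∧
      B p ⟨2 * j + 1, by omega⟩ = gaussH σ (t i - t j) c 1 := by
    intro j
    constructor
    · have e1 : (⟨2 * (j : ℕ) / 2, by omega⟩ : Fin k) = j := Fin.ext (by simp)
      have e2 : (⟨2 * (j : ℕ) % 2, by omega⟩ : Fin 2) = 0 := Fin.ext (by simp)
      rw [hB, ← hi, ← hc]
      simp only [e1, e2]
    · have e1 : (⟨(2 * (j : ℕ) + 1) / 2, by omega⟩ : Fin k) = j := Fin.ext (by simp only; omega)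
      have e2 : (⟨(2 * (j : ℕ) + 1) % 2, by omega⟩ : Fin 2) = 1 :=
        Fin.ext (by simp only [Fin.val_one]; omega)
      rw [hB, ← hi, ← hc]
      simp only [e1, e2]
  have hpp : B p p = gaussH σ 0 c c := by
    rw [hB, ← hi, ← hc, sub_self]
  have hppv : |B p p| = B p p ∧
      |gaussH σ 0 c 0| + |gaussH σ 0 c 1| = B p p := by
    rw [hpp]
    obtain ⟨h00, h01, h10, h11⟩ := hH 0
    have ha0 : |a| = a := abs_of_nonneg (by linarith)
    fin_cases c
    · simp [h00, h01]
    · simp [h10, h11, ha0]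
  have hoff : ∑ q ∈ Finset.univ.erase p, |B p q| =
      ∑ j ∈ Finset.univ.erase i,
        (|gaussH σ (t i - t j) c 0| + |gaussH σ (t i - t j) c 1|) := by
    have h1 := Finset.add_sum_erase Finset.univ (fun q => |B p q|) (Finset.mem_univ p)
    have h2 := aux_reindex (fun q => |B p q|)
    have h3 : ∀ j : Fin k, |B p ⟨2 * j, by omega⟩| + |B p ⟨2 * j + 1, by omega⟩| =
        |gaussH σ (t i - t j) c 0| + |gaussH σ (t i - t j) c 1| := by
      intro j
      rw [(hrow j).1, (hrow j).2]
    simp only [h3] at h2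
    have h4 := Finset.add_sum_erase Finset.univ
      (fun j => |gaussH σ (t i - t j) c 0| + |gaussH σ (t i - t j) c 1|) (Finset.mem_univ i)
    simp only [sub_self] at h4
    rw [hppv.1] at h1
    rw [hppv.2] at h4
    linarith
  have hd1 : ∀ j, |t i - t j| ≤ 1 := by
    intro j
    have := ht i
    have := ht j
    simp only [Set.mem_Icc] at *
    rw [abs_le]
    constructor <;> linarith
  have hgeo2 := aux_geom i (pow_nonneg hr0.le 2) hr1
  have hdx : ∀ j, j ≠ i → (1 + 3 * (aux_m i j : ℝ)) * x ≤ a / 2 * (t i - t j) ^ 2 := by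
    intro j hj
    have h1 := aux_sep2 hsep i j hj
    have h2 : ((aux_m i j + 1 : ℝ) * Δ) ^ 2 ≤ (t i - t j) ^ 2 := by
      rw [← sq_abs (t i - t j)]
      exact pow_le_pow_left₀ (by positivity) h1 2
    have h3 : (1 + 3 * (aux_m i j : ℝ)) ≤ (aux_m i j + 1 : ℝ) ^ 2 := by
      rcases Nat.eq_zero_or_pos (aux_m i j) with h | h
      · rw [h]; norm_num
      · have : (1 : ℝ) ≤ aux_m i j := by exact_mod_cast h
        nlinarith
    have h4 : (1 + 3 * (aux_m i j : ℝ)) * Δ ^ 2 ≤ (t i - t j) ^ 2 := by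
      rw [mul_pow] at h2
      exact (mul_le_mul_of_nonneg_right h3 (sq_nonneg _)).trans h2
    have h5 := mul_le_mul_of_nonneg_left h4 (show 0 ≤ a / 2 by linarith)
    rw [hx]
    linarith
  have hE1 : ∀ j, j ≠ i → Real.exp (-(a / 2 * (t i - t j) ^ 2)) ≤ r ^ 2 * (r ^ 2) ^ (aux_m i j) := by
    intro j hj
    have h : r ^ 2 * (r ^ 2) ^ (aux_m i j) = Real.exp (-((1 + (aux_m i j : ℝ)) * x)) := by
      rw [← hq, ← Real.exp_nat_mul, ← Real.exp_add]; ring_nf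
    rw [h, Real.exp_le_exp]
    have := hdx j hj
    have : 0 ≤ (aux_m i j : ℝ) * x := by positivity
    linarith
  have hE2 : ∀ j, j ≠ i →
      Real.exp (-(a / 2 * (t i - t j) ^ 2) / 2) ≤ r * (r ^ 3) ^ (aux_m i j) := by
    intro j hj
    have h : r * (r ^ 3) ^ (aux_m i j) = Real.exp (-((1 + 3 * (aux_m i j : ℝ)) * x) / 2) := by
      rw [hr, ← Real.exp_nat_mul, ← Real.exp_nat_mul, ← Real.exp_add]
      congr 1; push_cast; ring
    rw [h, Real.exp_le_exp]
    have := hdx j hj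
    linarith
  have hS1 : ∑ j ∈ Finset.univ.erase i, r ^ 2 * (r ^ 2) ^ (aux_m i j)
      ≤ 2 * r ^ 2 / (1 - r ^ 2) := by
    rw [← Finset.mul_sum]
    have := mul_le_mul_of_nonneg_left hgeo2 (sq_nonneg r)
    calc _ ≤ _ := this
      _ = _ := by rw [div_eq_mul_inv]; ring
  have hc01 : c = 0 ∨ c = 1 := by fin_cases c <;> simp
  rw [hoff, hpp] at hlow
  rcases hc01 with h0 | h0
  · subst h0
    rw [(hH 0).1] at hlow
    have : ∑ j ∈ Finset.univ.erase i,
        (|gaussH σ (t i - t j) 0 0| + |gaussH σ (t i - t j) 0 1|) ≤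
        (1 + a) * (2 * r ^ 2 / (1 - r ^ 2)) := by
      refine le_trans ?_ (mul_le_mul_of_nonneg_left hS1 (by linarith))
      rw [Finset.mul_sum]
      apply Finset.sum_le_sum
      intro j hj
      rw [(hH _).1, (hH _).2.1]
      refine (aux_row0 (by linarith) (hd1 j) _ (Real.exp_pos _).le).trans ?_
      exact mul_le_mul_of_nonneg_left (hE1 j (Finset.ne_of_mem_erase hj)) (by linarith)
    simp only [ne_eq, OfNat.ofNat_ne_zero, not_false_eq_true, zero_pow, mul_zero, neg_zero,
      Real.exp_zero] at hlow
    linarith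
  · subst h0
    rw [(hH 0).2.2.2] at hlow
    simp only [ne_eq, OfNat.ofNat_ne_zero, not_false_eq_true, zero_pow, mul_zero, sub_zero,
      neg_zero, Real.exp_zero, mul_one] at hlow
    by_cases hne : ∃ j, j ≠ i
    · obtain ⟨j₀, hj₀⟩ := hne
      have ha4 : 4.1 ≤ a := by
        apply aux_a ha1
        refine hxlog.trans_le ?_
        have h1 := hdx j₀ hj₀
        have h2 : 0 ≤ (aux_m i j₀ : ℝ) * x := by positivity
        have h3 : (t i - t j₀) ^ 2 ≤ 1 := by
          rw [sq_le_one_iff_abs_le_one]; exact hd1 j₀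
        nlinarith
      have hr3 : r ≤ 0.3 := aux_r hr0 ha4 hqlt
      have hr27 : r ^ 3 ≤ 0.027 := by
        calc r ^ 3 ≤ 0.3 ^ 3 := pow_le_pow_left₀ hr0.le hr3 3
          _ = 0.027 := by norm_num
      have hgeo3 := aux_geom i (pow_nonneg hr0.le 3) (by linarith : r ^ 3 < 1)
      have hS2 : ∑ j ∈ Finset.univ.erase i, r * (r ^ 3) ^ (aux_m i j) ≤ 0.62 := by
        rw [← Finset.mul_sum]
        have h1 : (1 - r ^ 3)⁻¹ ≤ 0.973⁻¹ := by
          apply inv_anti₀ (by norm_num); linarith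
        have h2 : ∑ j ∈ Finset.univ.erase i, (r ^ 3) ^ (aux_m i j) ≤ 2 * 0.973⁻¹ := by linarith
        calc _ ≤ 0.3 * (2 * (0.973 : ℝ)⁻¹) :=
              mul_le_mul hr3 h2 (Finset.sum_nonneg fun j _ => by positivity) (by norm_num)
          _ ≤ 0.62 := by norm_num
      have hsum : ∑ j ∈ Finset.univ.erase i,
          (|gaussH σ (t i - t j) 1 0| + |gaussH σ (t i - t j) 1 1|) ≤
          a * (2 * r ^ 2 / (1 - r ^ 2)) + 1.2 * a * 0.62 := by
        refine le_trans ?_ (add_le_add (mul_le_mul_of_nonneg_left hS1 (by linarith))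
          (mul_le_mul_of_nonneg_left hS2 (by linarith)))
        rw [Finset.mul_sum, Finset.mul_sum, ← Finset.sum_add_distrib]
        apply Finset.sum_le_sum
        intro j hj
        have hji := Finset.ne_of_mem_erase hj
        rw [(hH _).2.2.1, (hH _).2.2.2]
        have hxx : 1 ≤ a / 2 * (t i - t j) ^ 2 := by
          have h1 := hdx j hji
          have h2 : 0 ≤ (aux_m i j : ℝ) * x := by positivity
          linarith
        refine (aux_row1 (by linarith) (hd1 j) hxx).trans ?_
        exact add_le_add (mul_le_mul_of_nonneg_left (hE1 j hji) (by linarith))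
          (mul_le_mul_of_nonneg_left (hE2 j hji) (by linarith))
      have hpos : 0 ≤ 2 * r ^ 2 / (1 - r ^ 2) :=
        div_nonneg (by positivity) (by linarith)
      linarith
    · push Not at hne
      have : (Finset.univ.erase i : Finset (Fin k)) = ∅ := by
        ext j; simp [hne j]
      rw [this] at hlow
      simp at hlow
      linarith
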